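/- Let x_* be a minimizer of F. Consider sequences {x_k}_{k≥−1} ⊂ ℝⁿ, {y_k}_{k≥1} ⊂ ℝⁿ, {t_k}_{k≥1}, {σ_k}_{k≥1} with σ_k > 0, and symmetric positive definite matrices {H_k}_{k≥1} satisfying: x_{−1} = x_0, y_1 = x_0, t_1 = 1, σ_1 = 1, H_1 = I; for every k ≥ 1, t_{k+1} = (1/2)(1 + √(1 + 4 (σ_k/σ_{k+1}) t_k²)), x_k = p_{H_k}(y_k) with F(x_k) ≤ Q_{H_k}(x_k, y_k), y_{k+1} = x_k + ((t_k − 1)/t_{k+1})(x_k − x_{k−1}), and σ_{k+1} H_{k+1} ⪯ σ_k H_k. If there exists σ̲ > 0 such that σ_k ≥ σ̲/k for all k ≥ 1, then for every k ≥ 1, F(x_k) − F(x_*) ≤ 2‖x_0 − x_*‖² / (σ̲ k). -/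

import Mathlib

open scoped RealInnerProductSpace
open Finset

/-- Matrix-vector product, viewed as an operation on Euclidean space. -/
noncomputable def mulVecE {n : ℕ} (H : Matrix (Fin n) (Fin n) ℝ)
    (w : EuclideanSpace ℝ (Fin n)) : EuclideanSpace ℝ (Fin n) :=
  (WithLp.equiv 2 (Fin n → ℝ)).symm (H.mulVec ((WithLp.equiv 2 (Fin n → ℝ)) w))

/-- The composite quadratic approximation
`Q_H(u,v) = f(v) + ⟨∇f(v), u−v⟩ + (1/2)⟨H(u−v), u−v⟩ + g(u)`. -/
noncomputable def Qa {n : ℕ} (f g : EuclideanSpace ℝ (Fin n) → ℝ)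
    (H : Matrix (Fin n) (Fin n) ℝ) (u v : EuclideanSpace ℝ (Fin n)) : ℝ :=
  f v + ⟪ gradient f v, u - v ⟫ + (1 / 2) * ⟪ mulVecE H (u - v), u - v ⟫ + g u

theorem mulVecE_add {n : ℕ} (H : Matrix (Fin n) (Fin n) ℝ) (a b : EuclideanSpace ℝ (Fin n)) :
    mulVecE H (a + b) = mulVecE H a + mulVecE H b := by
  simp [mulVecE, Matrix.mulVec_add]

theorem mulVecE_smul {n : ℕ} (H : Matrix (Fin n) (Fin n) ℝ) (c : ℝ)
    (a : EuclideanSpace ℝ (Fin n)) : mulVecE H (c • a) = c • mulVecE H a := by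
  simp [mulVecE, Matrix.mulVec_smul]

theorem mulVecE_sub {n : ℕ} (H : Matrix (Fin n) (Fin n) ℝ) (a b : EuclideanSpace ℝ (Fin n)) :
    mulVecE H (a - b) = mulVecE H a - mulVecE H b := by
  simp [mulVecE, Matrix.mulVec_sub]

theorem mulVecE_one {n : ℕ} (a : EuclideanSpace ℝ (Fin n)) :
    mulVecE (1 : Matrix (Fin n) (Fin n) ℝ) a = a := by
  simp [mulVecE]

theorem mulVecE_smul_sub_smul {n : ℕ} (A B : Matrix (Fin n) (Fin n) ℝ) (c d : ℝ)
    (a : EuclideanSpace ℝ (Fin n)) :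
    mulVecE (c • A - d • B) a = c • mulVecE A a - d • mulVecE B a := by
  simp [mulVecE, Matrix.sub_mulVec, Matrix.smul_mulVec]

theorem Matrix.PosSemidef.inner_mulVecE_nonneg {n : ℕ} {H : Matrix (Fin n) (Fin n) ℝ}
    (hH : H.PosSemidef) (a : EuclideanSpace ℝ (Fin n)) : 0 ≤ ⟪mulVecE H a, a⟫ := by
  have h := hH.dotProduct_mulVec_nonneg (WithLp.ofLp a)
  simpa [mulVecE, EuclideanSpace.inner_eq_star_dotProduct] using h

theorem inner_mulVecE_smul_self {n : ℕ} (H : Matrix (Fin n) (Fin n) ℝ) (c : ℝ)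
    (a : EuclideanSpace ℝ (Fin n)) :
    ⟪mulVecE H (c • a), c • a⟫ = c ^ 2 * ⟪mulVecE H a, a⟫ := by
  rw [mulVecE_smul, real_inner_smul_left, real_inner_smul_right]
  ring

theorem inner_mulVecE_convexCombo {n : ℕ} (H : Matrix (Fin n) (Fin n) ℝ) (s : ℝ)
    (a b : EuclideanSpace ℝ (Fin n)) :
    ⟪mulVecE H ((1 - s) • a + s • b), (1 - s) • a + s • b⟫ =
      (1 - s) * ⟪mulVecE H a, a⟫ + s * ⟪mulVecE H b, b⟫
        - s * (1 - s) * ⟪mulVecE H (b - a), b - a⟫ := by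
  simp only [mulVecE_add, mulVecE_smul, mulVecE_sub, inner_add_left, inner_add_right,
    inner_sub_left, inner_sub_right, real_inner_smul_left, real_inner_smul_right]
  ring

theorem ConvexOn.add_inner_gradient_le {E : Type*} [NormedAddCommGroup E]
    [InnerProductSpace ℝ E] [CompleteSpace E] {f : E → ℝ} (hf : ConvexOn ℝ Set.univ f)
    {v : E} (hfd : DifferentiableAt ℝ f v) (u : E) :
    f v + ⟪gradient f v, u - v⟫ ≤ f u := by
  have hconv : ConvexOn ℝ Set.univ (f ∘ AffineMap.lineMap (k := ℝ) v u) := by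
    simpa using hf.comp_affineMap (AffineMap.lineMap (k := ℝ) v u)
  have hder : HasDerivAt (f ∘ AffineMap.lineMap (k := ℝ) v u) ⟪gradient f v, u - v⟫ 0 := by
    have hfd' : HasFDerivAt f (fderiv ℝ f v) (AffineMap.lineMap (k := ℝ) v u 0) := by
      simpa using hfd.hasFDerivAt
    have h := hfd'.comp_hasDerivAt (0 : ℝ) (AffineMap.hasDerivAt_lineMap (a := v) (b := u))
    rwa [← toDual_gradient, InnerProductSpace.toDual_apply_apply] at h
  have h := hconv.le_slope_of_hasDerivAt (Set.mem_univ _) (Set.mem_univ _) zero_lt_one hder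
  simp only [slope_def_field, Function.comp_apply, AffineMap.lineMap_apply_one,
    AffineMap.lineMap_apply_zero, sub_zero, div_one] at h
  linarith

theorem Qa_convexCombo_le {n : ℕ} {f g : EuclideanSpace ℝ (Fin n) → ℝ}
    (hg : ConvexOn ℝ Set.univ g) (H : Matrix (Fin n) (Fin n) ℝ)
    (p u v : EuclideanSpace ℝ (Fin n)) {s : ℝ} (hs₀ : 0 ≤ s) (hs₁ : s ≤ 1) :
    Qa f g H ((1 - s) • p + s • u) v ≤ (1 - s) * Qa f g H p v + s * Qa f g H u v
      - s * (1 - s) / 2 * ⟪mulVecE H (u - p), u - p⟫ := by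
  have hgs := hg.2 (Set.mem_univ p) (Set.mem_univ u) (sub_nonneg.2 hs₁) hs₀ (by ring)
  have hv : (1 - s) • p + s • u - v = (1 - s) • (p - v) + s • (u - v) := by module
  have hq := inner_mulVecE_convexCombo H s (p - v) (u - v)
  rw [sub_sub_sub_cancel_right] at hq
  simp only [smul_eq_mul] at hgs
  simp only [Qa]
  rw [hv, hq, inner_add_right, real_inner_smul_right, real_inner_smul_right]
  linarith

theorem Qa_add_le_of_isMin {n : ℕ} {f g : EuclideanSpace ℝ (Fin n) → ℝ}
    (hg : ConvexOn ℝ Set.univ g) {H : Matrix (Fin n) (Fin n) ℝ}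
    {p v : EuclideanSpace ℝ (Fin n)} (hmin : ∀ u, Qa f g H p v ≤ Qa f g H u v)
    (u : EuclideanSpace ℝ (Fin n)) :
    Qa f g H p v + 1 / 2 * ⟪mulVecE H (u - p), u - p⟫ ≤ Qa f g H u v := by
  have key : ∀ s : ℝ, 0 < s → s < 1 →
      Qa f g H p v + (1 - s) / 2 * ⟪mulVecE H (u - p), u - p⟫ ≤ Qa f g H u v := by
    intro s hs₀ hs₁
    have h := (hmin _).trans (Qa_convexCombo_le (f := f) hg H p u v hs₀.le hs₁.le)
    refine le_of_mul_le_mul_left ?_ hs₀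
    linarith
  have hlim : Filter.Tendsto
      (fun s : ℝ => Qa f g H p v + (1 - s) / 2 * ⟪mulVecE H (u - p), u - p⟫)
      (nhdsWithin 0 (Set.Ioi 0))
      (nhds (Qa f g H p v + (1 - 0) / 2 * ⟪mulVecE H (u - p), u - p⟫)) :=
    (Continuous.tendsto (by fun_prop) 0).mono_left nhdsWithin_le_nhds
  rw [sub_zero] at hlim
  refine le_of_tendsto hlim ?_
  filter_upwards [Ioo_mem_nhdsGT (zero_lt_one' ℝ)] with s hs using key s hs.1 hs.2

/-- The basic inequality of a proximal quasi-Newton step with sufficient decrease. -/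
theorem prox_step_le {n : ℕ} {f g : EuclideanSpace ℝ (Fin n) → ℝ}
    (hf : ConvexOn ℝ Set.univ f) (hfd : Differentiable ℝ f)
    (hg : ConvexOn ℝ Set.univ g) {H : Matrix (Fin n) (Fin n) ℝ}
    {p v : EuclideanSpace ℝ (Fin n)} (hmin : ∀ u, Qa f g H p v ≤ Qa f g H u v)
    (hdec : f p + g p ≤ Qa f g H p v) (u : EuclideanSpace ℝ (Fin n)) :
    f p + g p + 1 / 2 * ⟪mulVecE H (u - p), u - p⟫
      ≤ f u + g u + 1 / 2 * ⟪mulVecE H (u - v), u - v⟫ := by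
  have h₁ := Qa_add_le_of_isMin hg hmin u
  have h₂ := hf.add_inner_gradient_le (hfd v) u
  have h₃ : Qa f g H u v = f v + ⟪gradient f v, u - v⟫
    + 1 / 2 * ⟪mulVecE H (u - v), u - v⟫ + g u := rfl
  linarith

/-- One accelerated step, with the comparison point `(1 - 1/T) w + (1/T) z`. -/
theorem accelerated_step_le {n : ℕ} {f g : EuclideanSpace ℝ (Fin n) → ℝ}
    (hf : ConvexOn ℝ Set.univ f) (hfd : Differentiable ℝ f)
    (hg : ConvexOn ℝ Set.univ g) {H : Matrix (Fin n) (Fin n) ℝ}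
    {p v : EuclideanSpace ℝ (Fin n)} (hmin : ∀ u, Qa f g H p v ≤ Qa f g H u v)
    (hdec : f p + g p ≤ Qa f g H p v) (w z : EuclideanSpace ℝ (Fin n)) {T : ℝ} (hT : 1 ≤ T) :
    2 * T ^ 2 * (f p + g p - (f z + g z))
        + ⟪mulVecE H (T • p - (T - 1) • w - z), T • p - (T - 1) • w - z⟫
      ≤ 2 * (T * (T - 1)) * (f w + g w - (f z + g z))
        + ⟪mulVecE H (T • v - (T - 1) • w - z), T • v - (T - 1) • w - z⟫ := by
  have hT₀ : 0 < T := by linarith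
  set u := (1 - 1 / T) • w + (1 / T) • z with hu
  have hle : 1 / T ≤ 1 := (div_le_one hT₀).2 hT
  have hconv := (hf.add hg).2 (Set.mem_univ w) (Set.mem_univ z) (sub_nonneg.2 hle)
    (by positivity : 0 ≤ 1 / T) (by ring)
  simp only [Pi.add_apply, smul_eq_mul, ← hu] at hconv
  have hscale : ∀ q : EuclideanSpace ℝ (Fin n), T • q - (T - 1) • w - z = (-T) • (u - q) := by
    intro q
    rw [hu]
    match_scalars <;> field_simp
  rw [hscale p, hscale v, inner_mulVecE_smul_self, inner_mulVecE_smul_self]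
  have hstep := prox_step_le hf hfd hg hmin hdec u
  have hT2 := mul_le_mul_of_nonneg_left (hstep.trans (add_le_add_left hconv _)) (sq_nonneg T)
  have hexp : T ^ 2 * ((1 - 1 / T) * (f w + g w) + 1 / T * (f z + g z))
      = T * (T - 1) * (f w + g w) + T * (f z + g z) := by
    field_simp
  linarith

theorem one_le_of_sqrt_recurrence {σ t : ℕ → ℝ} (hσ : ∀ k, 1 ≤ k → 0 < σ k) (ht1 : t 1 = 1)
    (htrec : ∀ k, 1 ≤ k →
      t (k + 1) = (1 / 2) * (1 + Real.sqrt (1 + 4 * (σ k / σ (k + 1)) * t k ^ 2)))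
    {k : ℕ} (hk : 1 ≤ k) : 1 ≤ t k := by
  induction k, hk using Nat.le_induction with
  | base => exact ht1.ge
  | succ k hk _ =>
    have h₁ := hσ k hk
    have h₂ := hσ (k + 1) (by omega)
    have : 1 ≤ Real.sqrt (1 + 4 * (σ k / σ (k + 1)) * t k ^ 2) :=
      Real.one_le_sqrt.2 (le_add_of_nonneg_right (by positivity))
    rw [htrec k hk]
    linarith

theorem mul_sq_sub_of_sqrt_recurrence {σ t : ℕ → ℝ} (hσ : ∀ k, 1 ≤ k → 0 < σ k)
    (htrec : ∀ k, 1 ≤ k →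
      t (k + 1) = (1 / 2) * (1 + Real.sqrt (1 + 4 * (σ k / σ (k + 1)) * t k ^ 2)))
    {k : ℕ} (hk : 1 ≤ k) :
    σ (k + 1) * (t (k + 1) * (t (k + 1) - 1)) = σ k * t k ^ 2 := by
  have h₁ := hσ k hk
  have h₂ := hσ (k + 1) (by omega)
  have hsq := Real.sq_sqrt (x := 1 + 4 * (σ k / σ (k + 1)) * t k ^ 2) (by positivity)
  have h : t (k + 1) * (t (k + 1) - 1) = σ k / σ (k + 1) * t k ^ 2 := by
    rw [htrec k hk]
    linarith
  rw [h]
  field_simp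

theorem le_mul_sq_of_sqrt_recurrence {σ t : ℕ → ℝ} (hσ : ∀ k, 1 ≤ k → 0 < σ k)
    (ht1 : t 1 = 1) (hσ1 : σ 1 = 1)
    (htrec : ∀ k, 1 ≤ k →
      t (k + 1) = (1 / 2) * (1 + Real.sqrt (1 + 4 * (σ k / σ (k + 1)) * t k ^ 2)))
    {c : ℝ} (hc : 0 < c) (hlb : ∀ k : ℕ, 1 ≤ k → c / (k : ℝ) ≤ σ k) {k : ℕ} (hk : 1 ≤ k) :
    c * k / 4 ≤ σ k * t k ^ 2 := by
  induction k, hk using Nat.le_induction with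
  | base =>
    have := hlb 1 le_rfl
    simp only [Nat.cast_one, div_one, hσ1] at this
    rw [ht1, hσ1]
    norm_num
    linarith
  | succ k hk ih =>
    have hk' : (1 : ℝ) ≤ k := by exact_mod_cast hk
    have hpos := hσ (k + 1) (by omega)
    have ht := one_le_of_sqrt_recurrence hσ ht1 htrec (k := k + 1) (by omega)
    have hrec := mul_sq_sub_of_sqrt_recurrence hσ htrec hk
    have hl := hlb (k + 1) (by omega)
    push_cast at hl ⊢
    have hst : 0 < σ (k + 1) * t (k + 1) := by positivity
    have hsq : (c / 4) ^ 2 ≤ (σ (k + 1) * t (k + 1)) ^ 2 := by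
      calc (c / 4) ^ 2 ≤ c / (k + 1) * (c * k / 4) := by
            rw [div_mul_eq_mul_div, le_div_iff₀ (by positivity)]
            nlinarith [mul_nonneg (sq_nonneg c) (sub_nonneg.2 hk')]
        _ ≤ σ (k + 1) * (σ (k + 1) * t (k + 1) ^ 2) :=
            mul_le_mul hl (by nlinarith) (by positivity) hpos.le
        _ = (σ (k + 1) * t (k + 1)) ^ 2 := by ring
    have := le_of_sq_le_sq hsq hst.le
    linarith

theorem stmt16 {n : ℕ} (f g : EuclideanSpace ℝ (Fin n) → ℝ)
    (hf : ConvexOn ℝ Set.univ f) (hfd : Differentiable ℝ f)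
    (L : ℝ) (hL : 0 < L)
    (hflip : ∀ x y, ‖gradient f x - gradient f y‖ ≤ L * ‖x - y‖)
    (hg : ConvexOn ℝ Set.univ g) (hgc : Continuous g)
    (xs : EuclideanSpace ℝ (Fin n)) (hxs : ∀ z, f xs + g xs ≤ f z + g z)
    (x y : ℕ → EuclideanSpace ℝ (Fin n)) (t σ : ℕ → ℝ)
    (H : ℕ → Matrix (Fin n) (Fin n) ℝ)
    (hHpd : ∀ k, 1 ≤ k → (H k).PosDef)
    (hσpos : ∀ k, 1 ≤ k → 0 < σ k)
    (hy1 : y 1 = x 0) (ht1 : t 1 = 1) (hσ1 : σ 1 = 1)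
    (hH1 : H 1 = (1 : Matrix (Fin n) (Fin n) ℝ))
    (htrec : ∀ k, 1 ≤ k →
      t (k + 1) = (1 / 2) * (1 + Real.sqrt (1 + 4 * (σ k / σ (k + 1)) * t k ^ 2)))
    (hmin : ∀ k, 1 ≤ k → ∀ u, Qa f g (H k) (x k) (y k) ≤ Qa f g (H k) u (y k))
    (hdec : ∀ k, 1 ≤ k → f (x k) + g (x k) ≤ Qa f g (H k) (x k) (y k))
    (hyrec : ∀ k, 1 ≤ k →
      y (k + 1) = x k + ((t k - 1) / t (k + 1)) • (x k - x (k - 1)))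
    (hLoew : ∀ k, 1 ≤ k → (σ k • H k - σ (k + 1) • H (k + 1)).PosSemidef)
    (σlb : ℝ) (hσlb : 0 < σlb) (hlb : ∀ k : ℕ, 1 ≤ k → σlb / (k : ℝ) ≤ σ k) :
    ∀ k : ℕ, 1 ≤ k →
      (f (x k) + g (x k)) - (f xs + g xs) ≤ 2 * ‖x 0 - xs‖ ^ 2 / (σlb * (k : ℝ)) := by
  have ht := fun {k : ℕ} => one_le_of_sqrt_recurrence hσpos ht1 htrec (k := k)
  have hpot : ∀ k, 1 ≤ k →
      2 * (σ k * t k ^ 2) * (f (x k) + g (x k) - (f xs + g xs))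
        + σ k * ⟪mulVecE (H k) (t k • x k - (t k - 1) • x (k - 1) - xs),
            t k • x k - (t k - 1) • x (k - 1) - xs⟫ ≤ ‖x 0 - xs‖ ^ 2 := by
    intro k hk
    induction k, hk using Nat.le_induction with
    | base =>
      have h := accelerated_step_le hf hfd hg (hmin 1 le_rfl) (hdec 1 le_rfl) (x 0) xs
        (le_refl (1 : ℝ))
      rw [hy1, hH1] at h
      simp only [mulVecE_one, real_inner_self_eq_norm_sq, sub_self, one_smul, zero_smul,
        sub_zero, mul_zero, zero_mul, zero_add] at h
      simpa [ht1, hσ1, hH1, mulVecE_one] using h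
    | succ k hk ih =>
      have hk1 : 1 ≤ k + 1 := by omega
      have hT := ht hk1
      have h := accelerated_step_le hf hfd hg (hmin _ hk1) (hdec _ hk1) (x k) xs hT
      have hT₀ : t (k + 1) ≠ 0 := by positivity
      have hu : t (k + 1) • y (k + 1) - (t (k + 1) - 1) • x k - xs
          = t k • x k - (t k - 1) • x (k - 1) - xs := by
        rw [hyrec k hk, smul_add, smul_smul, mul_div_cancel₀ _ hT₀]
        module
      rw [hu] at h
      have hσh := mul_le_mul_of_nonneg_left h (hσpos _ hk1).le
      have hloew := (hLoew k hk).inner_mulVecE_nonneg (t k • x k - (t k - 1) • x (k - 1) - xs)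
      rw [mulVecE_smul_sub_smul, inner_sub_left, real_inner_smul_left,
        real_inner_smul_left] at hloew
      have hrec := mul_sq_sub_of_sqrt_recurrence hσpos htrec hk
      rw [← hrec] at ih
      rw [Nat.add_sub_cancel]
      linarith
  intro k hk
  have hk₀ : (0 : ℝ) < k := by exact_mod_cast hk
  have hquad := mul_nonneg (hσpos k hk).le ((hHpd k hk).posSemidef.inner_mulVecE_nonneg
    (t k • x k - (t k - 1) • x (k - 1) - xs))
  have hgrow := le_mul_sq_of_sqrt_recurrence hσpos ht1 hσ1 htrec hσlb hlb hk
  have hgap := mul_le_mul_of_nonneg_right hgrow (sub_nonneg.2 (hxs (x k)))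
  have hk_pot := hpot k hk
  rw [le_div_iff₀ (by positivity)]
  linarith
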